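/- arXiv:1606.06271 — 3 statements merged into one kernel-verified Lean document; each statement's English description precedes it below -/
import Mathlib

section
/- The dynamic-programming operator H is a contraction with contractivity factor γ under the sup-distance: for all bounded value functions v and v̄, ‖Hv − Hv̄‖ ≤ γ·‖v − v̄‖. -/
open scoped Classical
open Finset

noncomputable section PEG

/-- The standard probability simplex over a finite set `V`. -/
def simplex (V : Type*) [Fintype V] : Set (V → ℝ) :=
  {b | (∀ v, 0 ≤ b v) ∧ ∑ v, b v = 1}

/-- Evader one-step strategies: for each vertex `s`, a probability distribution over `V`
supported on `adj s`. -/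
def EStrat {V : Type*} [Fintype V] (adj : V → Finset V) : Set (V → V → ℝ) :=
  {π | ∀ s, (∀ s', 0 ≤ π s s') ∧ (∑ s', π s s' = 1) ∧ (∀ s', s' ∉ adj s → π s s' = 0)}

/-- Successor positions of the pursuer: move every unit along an edge. -/
def AdjF {V : Type*} [Fintype V] {N : ℕ} (adj : V → Finset V) (s_p : Fin N → V) :
    Finset (Fin N → V) :=
  Finset.univ.filter (fun t => ∀ i, t i ∈ adj (s_p i))

/-- Pursuer one-step strategies at `s_p`: distributions over `Adj(s_p)`. -/
def PStrat {V : Type*} [Fintype V] {N : ℕ} (adj : V → Finset V) (s_p : Fin N → V) :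
    Set ((Fin N → V) → ℝ) :=
  {π | (∀ t, 0 ≤ π t) ∧ ∑ t ∈ AdjF adj s_p, π t = 1}

/-- Probability mass on vertices occupied by the pursuer. -/
def capt {V : Type*} [Fintype V] {N : ℕ} (s_p : Fin N → V) (b : V → ℝ) : ℝ :=
  ∑ s ∈ Finset.univ.filter (fun s => ∃ i, s_p i = s), b s

/-- Probability mass on vertices not occupied by the pursuer, `m(s_p, b)`. -/
def escMass {V : Type*} [Fintype V] {N : ℕ} (s_p : Fin N → V) (b : V → ℝ) : ℝ :=
  ∑ s ∈ Finset.univ.filter (fun s => ¬ ∃ i, s_p i = s), b s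

/-- The updated belief `b_{π_e}` after the evader plays one-step strategy `π_e`. -/
def bUpd {V : Type*} [Fintype V] {N : ℕ} (s_p : Fin N → V) (b : V → ℝ)
    (π_e : V → V → ℝ) : V → ℝ :=
  fun s' => (1 / escMass s_p b) *
    ∑ s ∈ Finset.univ.filter (fun s => ¬ ∃ i, s_p i = s), b s * π_e s s'

/-- `Q^v_{π_p}⟨s_p⟩(b)`: the value of playing the one-step strategy `π_p` in the first round
and continuing with value `v`. -/
def Qval {V : Type*} [Fintype V] {N : ℕ} (adj : V → Finset V) (γ : ℝ)
    (v : (Fin N → V) → (V → ℝ) → ℝ) (s_p : Fin N → V) (π_p : (Fin N → V) → ℝ)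
    (b : V → ℝ) : ℝ :=
  if escMass s_p b = 0 then 1
  else capt s_p b + γ * escMass s_p b *
    sInf {x | ∃ π_e ∈ EStrat adj, x = ∑ t ∈ AdjF adj s_p, π_p t * v t (bUpd s_p b π_e)}

/-- The dynamic-programming operator `H`. -/
def Hop {V : Type*} [Fintype V] {N : ℕ} (adj : V → Finset V) (γ : ℝ)
    (v : (Fin N → V) → (V → ℝ) → ℝ) : (Fin N → V) → (V → ℝ) → ℝ :=
  fun s_p b => sSup {x | ∃ π_p ∈ PStrat adj s_p, x = Qval adj γ v s_p π_p b}

/-- The sup-distance `‖v − v̄‖` between value functions (over beliefs in the simplex). -/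
def supDist {V : Type*} [Fintype V] {N : ℕ} (v w : (Fin N → V) → (V → ℝ) → ℝ) : ℝ :=
  sSup {x | ∃ s_p : Fin N → V, ∃ b ∈ simplex V, x = |v s_p b - w s_p b|}

/-- A value function is bounded. -/
def BoundedVF {V : Type*} [Fintype V] {N : ℕ} (v : (Fin N → V) → (V → ℝ) → ℝ) : Prop :=
  ∃ C : ℝ, ∀ s_p : Fin N → V, ∀ b ∈ simplex V, |v s_p b| ≤ C

/-- A value function is `[0,1]`-valued. -/
def UnitValued {V : Type*} [Fintype V] {N : ℕ} (v : (Fin N → V) → (V → ℝ) → ℝ) : Prop :=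
  ∀ s_p : Fin N → V, ∀ b ∈ simplex V, 0 ≤ v s_p b ∧ v s_p b ≤ 1

end PEG

section Contraction

variable {V : Type*} [Fintype V] {N : ℕ}

theorem EStrat_nonempty {adj : V → Finset V} (hadj : ∀ s, (adj s).Nonempty) :
    (EStrat adj).Nonempty := by
  choose f hf using hadj
  refine ⟨fun s => Pi.single (f s) 1, fun s => ⟨fun s' => ?_, ?_, fun s' hs' => ?_⟩⟩
  · by_cases h : s' = f s
    · subst h; simp
    · simp [h]
  · simp
  · have h : s' ≠ f s := fun h => hs' (h ▸ hf s)
    simp [h]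

theorem PStrat_nonempty {adj : V → Finset V} (hadj : ∀ s, (adj s).Nonempty)
    (s_p : Fin N → V) : (PStrat adj s_p).Nonempty := by
  choose f hf using hadj
  have hmem : (fun i => f (s_p i)) ∈ AdjF adj s_p := by
    simp [AdjF, hf]
  refine ⟨fun t => if t = fun i => f (s_p i) then 1 else 0, fun t => ?_, ?_⟩
  · dsimp only
    split_ifs <;> norm_num
  · rw [Finset.sum_ite_eq' (AdjF adj s_p), if_pos hmem]

theorem escMass_nonneg (s_p : Fin N → V) {b : V → ℝ} (hb : b ∈ simplex V) :
    0 ≤ escMass s_p b :=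
  Finset.sum_nonneg fun s _ => hb.1 s

theorem escMass_le_one (s_p : Fin N → V) {b : V → ℝ} (hb : b ∈ simplex V) :
    escMass s_p b ≤ 1 :=
  (Finset.sum_le_sum_of_subset_of_nonneg (Finset.filter_subset _ _)
    fun s _ _ => hb.1 s).trans_eq hb.2

theorem bUpd_mem_simplex {adj : V → Finset V} {s_p : Fin N → V} {b : V → ℝ}
    (hb : b ∈ simplex V) (hm : escMass s_p b ≠ 0) {π_e : V → V → ℝ} (hπ : π_e ∈ EStrat adj) :
    bUpd s_p b π_e ∈ simplex V := by
  refine ⟨fun s' => mul_nonneg (one_div_nonneg.2 (escMass_nonneg s_p hb))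
    (Finset.sum_nonneg fun s _ => mul_nonneg (hb.1 s) ((hπ s).1 s')), ?_⟩
  simp only [bUpd]
  rw [← Finset.mul_sum, Finset.sum_comm]
  simp only [← Finset.mul_sum, (hπ _).2.1, mul_one]
  exact one_div_mul_cancel hm

/-- Averages against a one-step pursuer strategy preserve upper bounds on differences. -/
theorem PStrat_sum_le_add {adj : V → Finset V} {s_p : Fin N → V} {π : (Fin N → V) → ℝ}
    (hπ : π ∈ PStrat adj s_p) {f g : (Fin N → V) → ℝ} {c : ℝ} (h : ∀ t, f t ≤ g t + c) :
    ∑ t ∈ AdjF adj s_p, π t * f t ≤ ∑ t ∈ AdjF adj s_p, π t * g t + c := by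
  calc ∑ t ∈ AdjF adj s_p, π t * f t
      ≤ ∑ t ∈ AdjF adj s_p, π t * (g t + c) :=
        Finset.sum_le_sum fun t _ => mul_le_mul_of_nonneg_left (h t) (hπ.1 t)
    _ = ∑ t ∈ AdjF adj s_p, π t * g t + c := by
        simp only [mul_add, Finset.sum_add_distrib, ← Finset.sum_mul, hπ.2, one_mul]

theorem bddBelow_evader_values {adj : V → Finset V} {v : (Fin N → V) → (V → ℝ) → ℝ}
    (hv : BoundedVF v) {s_p : Fin N → V} {π : (Fin N → V) → ℝ} (hπ : π ∈ PStrat adj s_p)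
    {b : V → ℝ} (hb : b ∈ simplex V) (hm : escMass s_p b ≠ 0) :
    BddBelow {x | ∃ π_e ∈ EStrat adj,
      x = ∑ t ∈ AdjF adj s_p, π t * v t (bUpd s_p b π_e)} := by
  obtain ⟨C, hC⟩ := hv
  refine ⟨-C, ?_⟩
  rintro x ⟨π_e, hπe, rfl⟩
  have h := PStrat_sum_le_add hπ (f := fun _ => 0) (g := fun t => v t (bUpd s_p b π_e)) (c := C)
    fun t => by linarith [(abs_le.1 (hC t _ (bUpd_mem_simplex hb hm hπe))).1]
  simp only [mul_zero, Finset.sum_const_zero] at h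
  linarith

theorem Qval_le_add {adj : V → Finset V} (hadj : ∀ s, (adj s).Nonempty) {γ : ℝ} (hγ : 0 ≤ γ)
    {v w : (Fin N → V) → (V → ℝ) → ℝ} (hv : BoundedVF v) {D : ℝ} (hD : 0 ≤ D)
    (hvw : ∀ s_p, ∀ b ∈ simplex V, v s_p b ≤ w s_p b + D) {s_p : Fin N → V}
    {π : (Fin N → V) → ℝ} (hπ : π ∈ PStrat adj s_p) {b : V → ℝ} (hb : b ∈ simplex V) :
    Qval adj γ v s_p π b ≤ Qval adj γ w s_p π b + γ * D := by
  unfold Qval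
  split_ifs with hm
  · linarith [mul_nonneg hγ hD]
  · obtain ⟨π₀, hπ₀⟩ := EStrat_nonempty hadj
    have hinf : sInf {x | ∃ π_e ∈ EStrat adj,
          x = ∑ t ∈ AdjF adj s_p, π t * v t (bUpd s_p b π_e)} - D ≤
        sInf {x | ∃ π_e ∈ EStrat adj,
          x = ∑ t ∈ AdjF adj s_p, π t * w t (bUpd s_p b π_e)} := by
      refine le_csInf ⟨_, π₀, hπ₀, rfl⟩ ?_
      rintro x ⟨π_e, hπe, rfl⟩
      have h₁ := csInf_le (bddBelow_evader_values hv hπ hb hm) ⟨π_e, hπe, rfl⟩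
      have h₂ := PStrat_sum_le_add hπ fun t => hvw t _ (bUpd_mem_simplex hb hm hπe)
      linarith
    have h₁ := mul_le_mul_of_nonneg_left hinf (mul_nonneg hγ (escMass_nonneg s_p hb))
    have h₂ := mul_le_mul_of_nonneg_left (escMass_le_one s_p hb) (mul_nonneg hγ hD)
    linarith

theorem bddAbove_Qval {adj : V → Finset V} (hadj : ∀ s, (adj s).Nonempty) {γ : ℝ} (hγ : 0 ≤ γ)
    {v : (Fin N → V) → (V → ℝ) → ℝ} (hv : BoundedVF v) (s_p : Fin N → V)
    {b : V → ℝ} (hb : b ∈ simplex V) :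
    BddAbove {x | ∃ π_p ∈ PStrat adj s_p, x = Qval adj γ v s_p π_p b} := by
  obtain ⟨C, hC⟩ := id hv
  have hC₀ : 0 ≤ C := (abs_nonneg _).trans (hC s_p b hb)
  refine ⟨Qval adj γ 0 s_p 0 b + γ * C, ?_⟩
  rintro x ⟨π, hπ, rfl⟩
  refine (Qval_le_add hadj hγ hv (w := 0) hC₀ (fun t b' hb' => ?_) hπ hb).trans_eq ?_
  · simpa using (abs_le.1 (hC t b' hb')).2
  · simp [Qval]

theorem Hop_le_add {adj : V → Finset V} (hadj : ∀ s, (adj s).Nonempty) {γ : ℝ} (hγ : 0 ≤ γ)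
    {v w : (Fin N → V) → (V → ℝ) → ℝ} (hv : BoundedVF v) (hw : BoundedVF w) {D : ℝ}
    (hD : 0 ≤ D) (hvw : ∀ s_p, ∀ b ∈ simplex V, v s_p b ≤ w s_p b + D) (s_p : Fin N → V)
    {b : V → ℝ} (hb : b ∈ simplex V) :
    Hop adj γ v s_p b ≤ Hop adj γ w s_p b + γ * D := by
  obtain ⟨π₀, hπ₀⟩ := PStrat_nonempty hadj s_p
  refine csSup_le ⟨_, π₀, hπ₀, rfl⟩ ?_
  rintro x ⟨π, hπ, rfl⟩
  have h : Qval adj γ w s_p π b ≤ Hop adj γ w s_p b :=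
    le_csSup (bddAbove_Qval hadj hγ hw s_p hb) ⟨π, hπ, rfl⟩
  linarith [Qval_le_add hadj hγ hv hD hvw hπ hb]

theorem supDist_nonneg (v w : (Fin N → V) → (V → ℝ) → ℝ) : 0 ≤ supDist v w := by
  refine Real.sSup_nonneg ?_
  rintro x ⟨s_p, b, -, rfl⟩
  exact abs_nonneg _

theorem abs_sub_le_supDist {v w : (Fin N → V) → (V → ℝ) → ℝ} (hv : BoundedVF v)
    (hw : BoundedVF w) (s_p : Fin N → V) {b : V → ℝ} (hb : b ∈ simplex V) :
    |v s_p b - w s_p b| ≤ supDist v w := by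
  obtain ⟨C, hC⟩ := hv
  obtain ⟨C', hC'⟩ := hw
  refine le_csSup ⟨C + C', ?_⟩ ⟨s_p, b, hb, rfl⟩
  rintro x ⟨t, b', hb', rfl⟩
  exact (abs_sub _ _).trans (add_le_add (hC t b' hb') (hC' t b' hb'))

end Contraction

/-- **Lemma 6 of the paper.** The dynamic-programming operator `H` is a
contraction with contractivity factor `γ` under the sup-distance: for all bounded value
functions `v, v̄`, `‖Hv − Hv̄‖ ≤ γ·‖v − v̄‖`. -/
theorem H_is_contraction {V : Type*} [Fintype V] [DecidableEq V] [Nonempty V]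
    (adj : V → Finset V) (hadj : ∀ s, (adj s).Nonempty)
    {N : ℕ} (hN : 0 < N) (γ : ℝ) (hγ0 : 0 ≤ γ) (hγ1 : γ < 1)
    (v w : (Fin N → V) → (V → ℝ) → ℝ) (hv : BoundedVF v) (hw : BoundedVF w) :
    supDist (Hop adj γ v) (Hop adj γ w) ≤ γ * supDist v w := by
  have hD := supDist_nonneg v w
  refine Real.sSup_le ?_ (mul_nonneg hγ0 hD)
  rintro x ⟨s_p, b, hb, rfl⟩
  have h₁ := Hop_le_add hadj hγ0 hv hw hD (fun t b' hb' => by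
    linarith [(abs_le.1 (abs_sub_le_supDist hv hw t hb')).2]) s_p hb
  have h₂ := Hop_le_add hadj hγ0 hw hv hD (fun t b' hb' => by
    linarith [(abs_le.1 (abs_sub_le_supDist hv hw t hb')).1]) s_p hb
  exact abs_le.2 ⟨by linarith, by linarith⟩
end

section
/- Let P ⊆ ℝ^n be the convex hull of a nonempty finite set of points (a compact polytope), S a finite set, and for each s ∈ S let f_s : ℝ^n → ℝ be a pointwise minimum of a nonempty finite family of affine functions, f_s(x) = min_{i ∈ I_s} (⟨a_{s,i}, x⟩ + c_{s,i}) with I_s nonempty and finite. Then there exists a finite set E ⊆ P such that for every weight vector b : S → ℝ with b(s) ≥ 0 for all s, there exists x* ∈ E with Σ_{s∈S} b(s)·f_s(x*) ≥ Σ_{s∈S} b(s)·f_s(x) for all x ∈ P; i.e., the maximum over P of the convex combination x ↦ Σ_s b(s)·f_s(x) is attained at a point of the fixed finite set E, independently of b. -/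
open Finset

theorem eventually_nonneg_add_mul_sub {p q : ℝ} (hp : 0 ≤ p) (h : p = 0 → q = 0) :
    ∀ᶠ t : ℝ in nhds 0, 0 ≤ p + t * (p - q) := by
  rcases hp.eq_or_lt with h0 | h0
  · simp [← h0, h h0.symm]
  · have hc : ContinuousAt (fun t : ℝ => p + t * (p - q)) 0 := by fun_prop
    exact (hc.eventually (lt_mem_nhds (by simpa using h0))).mono fun _ ht => le_of_lt ht

theorem eventually_ciInf_add_mul_sub_le {ι : Type*} [Finite ι] [Nonempty ι] {u v : ι → ℝ}
    (h : ∀ i, u i = ⨅ k, u k → v i = ⨅ k, v k) :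
    ∀ᶠ t : ℝ in nhds 0,
      (⨅ i, u i) + t * ((⨅ i, u i) - ⨅ i, v i) ≤ ⨅ i, (u i + t * (u i - v i)) := by
  have key : ∀ᶠ t : ℝ in nhds 0, ∀ i,
      0 ≤ (u i - ⨅ k, u k) + t * ((u i - ⨅ k, u k) - (v i - ⨅ k, v k)) :=
    Filter.eventually_all.2 fun i =>
      eventually_nonneg_add_mul_sub
        (sub_nonneg.2 (ciInf_le (Set.finite_range u).bddBelow i))
        fun hi => sub_eq_zero.2 (h i (sub_eq_zero.1 hi))
  filter_upwards [key] with t ht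
  exact le_ciInf fun i => by linarith [ht i]

theorem eventually_add_smul_sub_mem_convexHull {E : Type*} [AddCommGroup E] [Module ℝ E]
    {s : Finset E} {w w' : E → ℝ} (hw : ∀ y ∈ s, 0 ≤ w y) (hw1 : ∑ y ∈ s, w y = 1)
    (hw1' : ∑ y ∈ s, w' y = 1) (h : ∀ y ∈ s, w y = 0 → w' y = 0) :
    ∀ᶠ t : ℝ in nhds 0, (∑ y ∈ s, w y • y) + t • ((∑ y ∈ s, w y • y) - ∑ y ∈ s, w' y • y) ∈
      convexHull ℝ (s : Set E) := by
  have key : ∀ᶠ t : ℝ in nhds 0, ∀ y ∈ s, 0 ≤ w y + t * (w y - w' y) :=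
    (Filter.eventually_all_finset s).2 fun y hy =>
      eventually_nonneg_add_mul_sub (hw y hy) (h y hy)
  filter_upwards [key] with t ht
  refine Finset.mem_convexHull'.2 ⟨fun y => w y + t * (w y - w' y), ht, ?_, ?_⟩
  · rw [sum_add_distrib, ← mul_sum, sum_sub_distrib, hw1, hw1']
    ring
  · simp only [add_smul, mul_smul, sub_smul, sum_add_distrib, ← smul_sum, sum_sub_distrib]

theorem Set.exists_finset_subset_forall_exists_eq {α β : Type*} [Finite β] (s : Set α)
    (f : α → β) : ∃ E : Finset α, ↑E ⊆ s ∧ ∀ x ∈ s, ∃ e ∈ E, f e = f x := by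
  obtain ⟨t, hts, ht⟩ := s.exists_subset_bijOn f
  have hfin : t.Finite := Set.Finite.of_finite_image (Set.toFinite _) ht.injOn
  refine ⟨hfin.toFinset, by simpa using hts, fun x hx => ?_⟩
  obtain ⟨e, he, hex⟩ := ht.surjOn (Set.mem_image_of_mem f hx)
  exact ⟨e, hfin.mem_toFinset.2 he, hex⟩

theorem continuous_ciInf_of_finite {X ι : Type*} [TopologicalSpace X] [Finite ι] [Nonempty ι]
    {f : ι → X → ℝ} (hf : ∀ i, Continuous (f i)) : Continuous fun x => ⨅ i, f i x := by
  have := Fintype.ofFinite ι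
  simp only [← Finset.inf'_univ_eq_ciInf]
  exact Continuous.finset_inf'_apply _ fun i _ => hf i

/-- **core of Theorem 2 of the paper.** Let `P ⊆ ℝ^n` be the convex hull of
a nonempty finite set of points, and for each `s` in a finite set `S` let
`f_s x = min_{i ∈ I_s} (⟨a_{s,i}, x⟩ + c_{s,i})` be a pointwise minimum of a nonempty
finite family of affine functions. Then there is a finite set `E ⊆ P` such that for every
nonnegative weight vector `b : S → ℝ`, the maximum over `P` of
`x ↦ Σ_s b s * f_s x` is attained at some point of `E`, independently of `b`. -/
theorem finitely_many_maximizers_independent_of_belief {n : ℕ} {S : Type*} [Fintype S]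
    (pts : Finset (Fin n → ℝ)) (hpts : pts.Nonempty)
    (I : S → Type*) [∀ s, Fintype (I s)] [∀ s, Nonempty (I s)]
    (a : (s : S) → I s → (Fin n → ℝ)) (c : (s : S) → I s → ℝ) :
    ∃ E : Finset (Fin n → ℝ), ↑E ⊆ convexHull ℝ (pts : Set (Fin n → ℝ)) ∧
      ∀ b : S → ℝ, (∀ s, 0 ≤ b s) →
        ∃ xstar ∈ E, ∀ x ∈ convexHull ℝ (pts : Set (Fin n → ℝ)),
          ∑ s, b s * (⨅ i : I s, (∑ j, a s i j * x j + c s i)) ≤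
          ∑ s, b s * (⨅ i : I s, (∑ j, a s i j * xstar j + c s i)) := by
  classical
  set P := convexHull ℝ (pts : Set (Fin n → ℝ))
  set l : (s : S) → I s → (Fin n → ℝ) → ℝ := fun s i x => ∑ j, a s i j * x j + c s i with hl
  have hl_line : ∀ s i x e (t : ℝ), l s i (x + t • (x - e)) = l s i x + t * (l s i x - l s i e) := by
    intro s i x e t
    simp only [hl, Pi.add_apply, Pi.smul_apply, Pi.sub_apply, smul_eq_mul, mul_add, mul_sub,
      sum_add_distrib, sum_sub_distrib, mul_left_comm _ t, ← mul_sum]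
    ring
  have hweights : ∀ x, ∃ w : (Fin n → ℝ) → ℝ, x ∈ P →
      (∀ y ∈ pts, 0 ≤ w y) ∧ ∑ y ∈ pts, w y = 1 ∧ ∑ y ∈ pts, w y • y = x := by
    intro x
    by_cases hx : x ∈ P
    · obtain ⟨w, hw⟩ := Finset.mem_convexHull'.1 hx
      exact ⟨w, fun _ => hw⟩
    · exact ⟨0, fun h => absurd h hx⟩
  choose W hW using hweights
  -- Two points with the same vanishing weights and the same active affine pieces lie on a segment
  -- that extends beyond both and on which every `f_s` is affine.
  obtain ⟨E, hEP, hE⟩ := P.exists_finset_subset_forall_exists_eq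
    (fun x => ((fun y : pts => W x y = 0), (fun (s : S) (i : I s) => l s i x = ⨅ k, l s k x)))
  refine ⟨E, hEP, fun b hb => ?_⟩
  have hcont : Continuous fun x => ∑ s, b s * ⨅ i, l s i x :=
    continuous_finsetSum _ fun s _ => continuous_const.mul <|
      continuous_ciInf_of_finite fun i => by simp only [hl]; fun_prop
  obtain ⟨x, hxP, hx⟩ := (pts.finite_toSet.isCompact_convexHull ℝ).exists_isMaxOn
    (convexHull_nonempty_iff.2 hpts.to_set) hcont.continuousOn
  obtain ⟨e, heE, hpat⟩ := hE x hxP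
  refine ⟨e, heE, fun z hz => (hx hz).trans ?_⟩
  simp only [Prod.mk.injEq] at hpat
  obtain ⟨hzero, hactive⟩ := hpat
  obtain ⟨hw, hw1, hwx⟩ := hW x hxP
  obtain ⟨-, hw1', hwe⟩ := hW e (hEP heE)
  have hmem := eventually_add_smul_sub_mem_convexHull hw hw1 hw1'
    fun y hy h => (congrFun hzero ⟨y, hy⟩).mpr h
  rw [hwx, hwe] at hmem
  have hinf : ∀ᶠ t : ℝ in nhds 0, ∀ s, (⨅ i, l s i x) + t * ((⨅ i, l s i x) - ⨅ i, l s i e) ≤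
      ⨅ i, l s i (x + t • (x - e)) := by
    simp only [hl_line]
    exact Filter.eventually_all.2 fun s => eventually_ciInf_add_mul_sub_le
      fun i h => (congrFun (congrFun hactive s) i).mpr h
  obtain ⟨t, ⟨htmem, htinf⟩, ht⟩ :=
    (((hmem.and hinf).filter_mono nhdsWithin_le_nhds).and
      (self_mem_nhdsWithin : Set.Ioi (0 : ℝ) ∈ nhdsWithin 0 (Set.Ioi 0))).exists
  have hmax : ∑ s, b s * (⨅ i, l s i (x + t • (x - e))) ≤ ∑ s, b s * ⨅ i, l s i x := hx htmem
  have hsum := (sum_le_sum fun s _ => mul_le_mul_of_nonneg_left (htinf s) (hb s)).trans hmax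
  simp only [mul_add, mul_sub, mul_left_comm _ t, sum_add_distrib, sum_sub_distrib,
    ← mul_sum] at hsum
  rw [add_le_iff_nonpos_right, ← mul_sub] at hsum
  exact sub_nonpos.1 (nonpos_of_mul_nonpos_right hsum ht)
end

section
/- Fix a pursuer position s_p ∈ V^N, a pursuer one-step strategy π_p ∈ Δ(Adj(s_p)), and for each s_p¹ ∈ Adj(s_p) a vector α[s_p¹] : V → ℝ. Define α^σ : V → ℝ by α^σ(s) := 1 if s ∈ s_p, and α^σ(s) := γ·min_{s' ∈ adj(s)} Σ_{s_p¹ ∈ Adj(s_p)} π_p(s_p¹)·α[s_p¹](s') otherwise. Then for every b ∈ Δ(V) with m(s_p,b) > 0: γ·m(s_p,b)·inf_{π_e} Σ_{s_p¹ ∈ Adj(s_p)} π_p(s_p¹)·Σ_{s'∈V} α[s_p¹](s')·b_{π_e}(s') = Σ_{s ∉ s_p} b(s)·α^σ(s), where the infimum is over all evader one-step strategies π_e; consequently Σ_{s∈V} b(s)·α^σ(s) = Σ_{s∈s_p} b(s) + γ·m(s_p,b)·inf_{π_e} Σ_{s_p¹} π_p(s_p¹)·Σ_{s'} α[s_p¹](s')·b_{π_e}(s'),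 so the value of the composite strategy is the linear function of the belief represented by the α-vector α^σ. -/
open scoped Classical
open Finset

noncomputable section PEG2

/-- The `α`-vector `α^σ` of the composite strategy: play `π_p` in the first round, then
continue with the strategy represented by `α t` after moving to `t`. -/
def alphaSigma {V : Type*} [Fintype V] {N : ℕ} (adj : V → Finset V)
    (hadj : ∀ s, (adj s).Nonempty) (γ : ℝ) (s_p : Fin N → V)
    (π_p : (Fin N → V) → ℝ) (α : (Fin N → V) → V → ℝ) : V → ℝ :=
  fun s => if ∃ i, s_p i = s then 1
    else γ * (adj s).inf' (hadj s) (fun s' => ∑ t ∈ AdjF adj s_p, π_p t * α t s')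

end PEG2

/-- A weighted average of `f` with weights supported on `A` is at least the minimum of `f` on `A`. -/
theorem inf'_le_sum_mul_of_support {ι : Type*} [Fintype ι] (A : Finset ι) (hA : A.Nonempty)
    (w f : ι → ℝ) (hw : ∀ i, 0 ≤ w i) (hw1 : ∑ i, w i = 1) (hsupp : ∀ i, i ∉ A → w i = 0) :
    A.inf' hA f ≤ ∑ i, w i * f i := by
  calc A.inf' hA f = ∑ i, w i * A.inf' hA f := by rw [← Finset.sum_mul, hw1, one_mul]
    _ ≤ ∑ i, w i * f i := by
      refine Finset.sum_le_sum fun i _ => ?_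
      by_cases hi : i ∈ A
      · exact mul_le_mul_of_nonneg_left (Finset.inf'_le f hi) (hw i)
      · simp [hsupp i hi]

/-- Some evader strategy attains the minimum of `f` over the neighbours of every vertex. -/
theorem exists_mem_EStrat_sum_mul_eq_inf' {V : Type*} [Fintype V] (adj : V → Finset V)
    (hadj : ∀ s, (adj s).Nonempty) (f : V → ℝ) :
    ∃ π_e ∈ EStrat adj, ∀ s, ∑ s', π_e s s' * f s' = (adj s).inf' (hadj s) f := by
  choose c hc hcf using fun s => (adj s).exists_mem_eq_inf' (hadj s) f
  refine ⟨fun s s' => if s' = c s then 1 else 0, fun s => ⟨fun s' => ?_, ?_, fun s' hs' => ?_⟩,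
    fun s => ?_⟩
  · dsimp only
    split_ifs <;> norm_num
  · simp
  · exact if_neg (ne_of_mem_of_not_mem (hc s) hs').symm
  · simp [hcf s]

/-- The continuation value against `π_e`, as an average over the evader's current vertex. -/
theorem sum_mul_sum_mul_bUpd {V : Type*} [Fintype V] {N : ℕ} (T : Finset (Fin N → V))
    (s_p : Fin N → V) (π_p : (Fin N → V) → ℝ) (α : (Fin N → V) → V → ℝ) (b : V → ℝ)
    (π_e : V → V → ℝ) :
    ∑ t ∈ T, π_p t * ∑ s', α t s' * bUpd s_p b π_e s'
      = (1 / escMass s_p b) * ∑ s ∈ Finset.univ.filter (fun s => ¬ ∃ i, s_p i = s),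
          b s * ∑ s', π_e s s' * ∑ t ∈ T, π_p t * α t s' := by
  calc ∑ t ∈ T, π_p t * ∑ s', α t s' * bUpd s_p b π_e s'
      = ∑ s', (∑ t ∈ T, π_p t * α t s') * bUpd s_p b π_e s' := by
        simp only [Finset.mul_sum, Finset.sum_mul, mul_assoc]
        exact Finset.sum_comm
    _ = ∑ s', ∑ s ∈ Finset.univ.filter (fun s => ¬ ∃ i, s_p i = s),
          (1 / escMass s_p b) * (b s * (π_e s s' * ∑ t ∈ T, π_p t * α t s')) := by
        refine Finset.sum_congr rfl fun s' _ => ?_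
        rw [bUpd, ← Finset.mul_sum, mul_left_comm, Finset.mul_sum]
        congr 1
        exact Finset.sum_congr rfl fun s _ => by ring
    _ = _ := by
        rw [Finset.sum_comm]
        simp only [← Finset.mul_sum]

/-- The least continuation value is the average of the vertexwise minima. -/
theorem isLeast_continuation_value {V : Type*} [Fintype V] (adj : V → Finset V)
    (hadj : ∀ s, (adj s).Nonempty) {N : ℕ} (s_p : Fin N → V) (π_p : (Fin N → V) → ℝ)
    (α : (Fin N → V) → V → ℝ) (b : V → ℝ) (hb : ∀ s, 0 ≤ b s) (hm : 0 < escMass s_p b) :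
    IsLeast {x | ∃ π_e ∈ EStrat adj,
        x = ∑ t ∈ AdjF adj s_p, π_p t * ∑ s', α t s' * bUpd s_p b π_e s'}
      ((1 / escMass s_p b) * ∑ s ∈ Finset.univ.filter (fun s => ¬ ∃ i, s_p i = s),
        b s * (adj s).inf' (hadj s) (fun s' => ∑ t ∈ AdjF adj s_p, π_p t * α t s')) := by
  constructor
  · obtain ⟨π_e, hπ, h⟩ := exists_mem_EStrat_sum_mul_eq_inf' adj hadj
      (fun s' => ∑ t ∈ AdjF adj s_p, π_p t * α t s')
    refine ⟨π_e, hπ, ?_⟩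
    simp only [sum_mul_sum_mul_bUpd, h]
  · rintro x ⟨π_e, hπ, rfl⟩
    rw [sum_mul_sum_mul_bUpd]
    refine mul_le_mul_of_nonneg_left (Finset.sum_le_sum fun s _ => ?_) (by positivity)
    obtain ⟨h0, h1, h2⟩ := hπ s
    exact mul_le_mul_of_nonneg_left
      (inf'_le_sum_mul_of_support (adj s) (hadj s) _ _ h0 h1 h2) (hb s)

/-- **Lemma 4 of the paper, computational content.** For any choice of
continuation `α`-vectors `α[s_p¹]`, the minimized discounted continuation value equals the
linear function represented by `α^σ` on the escape mass, and consequently the value of the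
composite strategy is the linear function of the belief represented by `α^σ`. -/
theorem alphaSigma_represents_composite_value {V : Type*} [Fintype V] [DecidableEq V]
    [Nonempty V] (adj : V → Finset V) (hadj : ∀ s, (adj s).Nonempty)
    {N : ℕ} (hN : 0 < N) (γ : ℝ) (hγ0 : 0 ≤ γ) (hγ1 : γ < 1)
    (s_p : Fin N → V) (π_p : (Fin N → V) → ℝ) (hπp : π_p ∈ PStrat adj s_p)
    (α : (Fin N → V) → V → ℝ)
    (b : V → ℝ) (hb : b ∈ simplex V) (hm : 0 < escMass s_p b) :
    γ * escMass s_p b *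
      sInf {x | ∃ π_e ∈ EStrat adj,
        x = ∑ t ∈ AdjF adj s_p, π_p t * ∑ s', α t s' * bUpd s_p b π_e s'}
      = ∑ s ∈ Finset.univ.filter (fun s => ¬ ∃ i, s_p i = s),
          b s * alphaSigma adj hadj γ s_p π_p α s ∧
    ∑ s, b s * alphaSigma adj hadj γ s_p π_p α s
      = capt s_p b + γ * escMass s_p b *
        sInf {x | ∃ π_e ∈ EStrat adj,
          x = ∑ t ∈ AdjF adj s_p, π_p t * ∑ s', α t s' * bUpd s_p b π_e s'} := by
  obtain rfl : ‹DecidableEq V› = fun x y => Classical.propDecidable (x = y) :=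
    Subsingleton.elim _ _
  have key : γ * escMass s_p b *
      sInf {x | ∃ π_e ∈ EStrat adj,
        x = ∑ t ∈ AdjF adj s_p, π_p t * ∑ s', α t s' * bUpd s_p b π_e s'}
      = ∑ s ∈ Finset.univ.filter (fun s => ¬ ∃ i, s_p i = s),
          b s * alphaSigma adj hadj γ s_p π_p α s := by
    rw [(isLeast_continuation_value adj hadj s_p π_p α b hb.1 hm).csInf_eq, mul_assoc,
      ← mul_assoc (escMass s_p b), mul_one_div_cancel hm.ne', one_mul, Finset.mul_sum]
    refine Finset.sum_congr rfl fun s hs => ?_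
    rw [alphaSigma, if_neg (Finset.mem_filter.1 hs).2, mul_left_comm]
  refine ⟨key, ?_⟩
  rw [key, ← Finset.sum_filter_add_sum_filter_not Finset.univ (fun s => ∃ i, s_p i = s)]
  congr 1
  refine Finset.sum_congr rfl fun s hs => ?_
  rw [alphaSigma, if_pos (Finset.mem_filter.1 hs).2, mul_one]
end
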